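/- Let Ω ⊆ ℝ³ be open and R : Ω → SO(3) a C² matrix field with curl R = α for a constant α ∈ ℝ³ˣ³. Then |∇R|² = -tr(Rᵀ α Rᵀ α) pointwise on Ω, where |∇R|² = Σᵢ |∇Rᵢ|² is the squared Frobenius norm of the full derivative. -/

import Mathlib

open Matrix

/-- Partial derivative in the `i`-th coordinate direction. -/
noncomputable def pd {n : ℕ} (i : Fin n) (f : (Fin n → ℝ) → ℝ) (x : Fin n → ℝ) : ℝ :=
  fderiv ℝ f x (Pi.single i 1)

/-- The Levi-Civita symbol in dimension 3. -/
def eps (i j k : Fin 3) : ℝ :=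
  if (i, j, k) = (0, 1, 2) ∨ (i, j, k) = (1, 2, 0) ∨ (i, j, k) = (2, 0, 1) then 1
  else if (i, j, k) = (2, 1, 0) ∨ (i, j, k) = (0, 2, 1) ∨ (i, j, k) = (1, 0, 2) then -1
  else 0

theorem pd_diff {f : (Fin 3 → ℝ) → ℝ} {x : Fin 3 → ℝ} (hf : ContDiffAt ℝ 2 f x) (k : Fin 3) :
    DifferentiableAt ℝ (pd k f) x := by
  have h : DifferentiableAt ℝ (fderiv ℝ f) x :=
    (hf.fderiv_right (m := 1) (by norm_num)).differentiableAt (by norm_num)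
  unfold pd
  exact h.clm_apply (differentiableAt_const _)

theorem pd_symm {f : (Fin 3 → ℝ) → ℝ} {x : Fin 3 → ℝ} (hf : ContDiffAt ℝ 2 f x) (k l : Fin 3) :
    pd l (pd k f) x = pd k (pd l f) x := by
  have h : DifferentiableAt ℝ (fderiv ℝ f) x :=
    (hf.fderiv_right (m := 1) (by norm_num)).differentiableAt (by norm_num)
  have key : ∀ a b : Fin 3, pd a (pd b f) x
      = fderiv ℝ (fderiv ℝ f) x (Pi.single a 1) (Pi.single b 1) := by
    intro a b
    have := h.hasFDerivAt.clm_apply (hasFDerivAt_const (Pi.single b (1:ℝ) : Fin 3 → ℝ) x)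
    change fderiv ℝ (fun y => fderiv ℝ f y (Pi.single b 1)) x (Pi.single a 1) = _
    rw [this.fderiv]
    simp
  rw [key, key]
  have hs : IsSymmSndFDerivAt ℝ f x := hf.isSymmSndFDerivAt (by simp)
  exact hs _ _

theorem pd_sum_mul {ι : Type*} [Fintype ι] {f g : ι → (Fin 3 → ℝ) → ℝ} {x : Fin 3 → ℝ}
    (hf : ∀ i, DifferentiableAt ℝ (f i) x) (hg : ∀ i, DifferentiableAt ℝ (g i) x) (k : Fin 3)
    {c : ℝ} (h : ∀ᶠ y in nhds x, ∑ i, f i y * g i y = c) :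
    ∑ i, (pd k (f i) x * g i x + f i x * pd k (g i) x) = 0 := by
  have h1 : HasFDerivAt (fun y => ∑ i, f i y * g i y) _ x :=
    HasFDerivAt.fun_sum (u := Finset.univ) (fun i _ => (hf i).hasFDerivAt.mul (hg i).hasFDerivAt)
  have h2 : (fun y => ∑ i, f i y * g i y) =ᶠ[nhds x] fun _ => c := h
  have h3 := h2.fderiv_eq (𝕜 := ℝ)
  rw [h1.fderiv] at h3
  have h4 := congrArg (fun L => L (Pi.single k (1:ℝ))) h3
  simp [ContinuousLinearMap.sum_apply] at h4
  rw [← h4]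
  refine Finset.sum_congr rfl fun i _ => ?_
  unfold pd
  ring

/-- pure algebra, second order part -/
theorem alg_second (r : Fin 3 → Fin 3 → ℝ) (d : Fin 3 → Fin 3 → Fin 3 → ℝ)
    (s : Fin 3 → Fin 3 → Fin 3 → Fin 3 → ℝ)
    (h2 : ∀ l k i j, s l k i j = s k l i j)
    (h3 : ∀ l k a b, ∑ i, (s l k i a * r i b + d k i a * d l i b
      + d l i a * d k i b + r i a * s l k i b) = 0)
    (h4 : ∀ i l m, ∑ j, ∑ k, eps l j k * s m j i k = 0) :
    ∑ i, ∑ j, ∑ k, d k i j ^ 2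
      = 1 / 2 * ∑ k, ∑ j, ∑ i, (d k i k * d j i j + d j i k * d k i j) := by
  have e1 : ∑ k, ∑ j, ∑ i, (s k j i k * r i j + d j i k * d k i j
      + d k i k * d j i j + r i k * s k j i j) = 0 := by simp [h3]
  have e2 : ∑ k, ∑ j, ∑ i, (s k k i j * r i j + d k i j * d k i j
      + d k i j * d k i j + r i j * s k k i j) = 0 := by simp [h3]
  -- curl curl, row i
  have e3 : ∀ i n, ∑ k, (s k k i n - s k n i k) = 0 := by
    intro i n
    have a := h4 i
    simp only [Fin.forall_fin_succ, Fin.sum_univ_three, eps] at a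
    simp [Fin.ext_iff] at a
    fin_cases n <;> simp [Fin.sum_univ_three] <;> grind
  have e4 : ∑ i, ∑ n, r i n * ∑ k, (s k k i n - s k n i k) = 0 := by simp [e3]
  have e5 : ∑ k, ∑ j, ∑ i, s k j i k * r i j = ∑ k, ∑ j, ∑ i, r i k * s k j i j := by
    rw [Finset.sum_comm]
    refine Finset.sum_congr rfl fun k _ => Finset.sum_congr rfl fun j _ =>
      Finset.sum_congr rfl fun i _ => ?_
    rw [h2 k j]; ring
  simp only [Fin.sum_univ_three] at e1 e2 e4 e5 ⊢
  linear_combination (1/2) * e2 - e4 - (1/2) * e1 - (1/2) * e5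

theorem alg_first (W : Fin 3 → Fin 3 → Fin 3 → ℝ) (B : Matrix (Fin 3) (Fin 3) ℝ)
    (hW : ∀ k a b, W k a b = - W k b a)
    (hB : ∀ m l, B m l = ∑ j, ∑ k, eps l j k * W j m k)
    (h : ∑ i, ∑ j, ∑ k, W k i j ^ 2
      = 1 / 2 * ∑ k, ∑ j, ∑ i, (W k i k * W j i j + W j i k * W k i j)) :
    ∑ i, ∑ j, ∑ k, W k i j ^ 2 = - Matrix.trace (B * B) := by
  have z : ∀ k a, W k a a = 0 := fun k a => by linarith [hW k a a]
  have w1 : ∀ k, W k 1 0 = - W k 0 1 := fun k => hW k 1 0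
  have w2 : ∀ k, W k 2 0 = - W k 0 2 := fun k => hW k 2 0
  have w3 : ∀ k, W k 2 1 = - W k 1 2 := fun k => hW k 2 1
  simp only [Matrix.trace, Matrix.diag, Matrix.mul_apply, Fin.sum_univ_three, hB, eps] at h ⊢
  simp [Fin.ext_iff, z, w1, w2, w3] at h ⊢
  linear_combination 2 * h

theorem norm_sq_gradient_of_rotation_field
    (Ω : Set (Fin 3 → ℝ)) (hΩ : IsOpen Ω)
    (R : (Fin 3 → ℝ) → Fin 3 → Fin 3 → ℝ) (hR : ContDiffOn ℝ 2 R Ω)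
    (hSO : ∀ x ∈ Ω, (Matrix.of (R x))ᵀ * Matrix.of (R x) = 1 ∧ (Matrix.of (R x)).det = 1)
    (α : Matrix (Fin 3) (Fin 3) ℝ)
    (hcurl : ∀ x ∈ Ω, ∀ i l : Fin 3,
      ∑ j, ∑ k, eps l j k * pd j (fun y => R y i k) x = α i l) :
    ∀ x ∈ Ω,
      ∑ i, ∑ j, ∑ k, (pd k (fun y => R y i j) x) ^ 2
        = - Matrix.trace ((Matrix.of (R x))ᵀ * α * (Matrix.of (R x))ᵀ * α) := by
  intro x hx
  have hc : ∀ y ∈ Ω, ∀ i j, ContDiffAt ℝ 2 (fun y => R y i j) y := fun y hy i j =>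
    contDiffAt_pi.1 (contDiffAt_pi.1 (hR.contDiffAt (hΩ.mem_nhds hy)) i) j
  have hd : ∀ y ∈ Ω, ∀ i j, DifferentiableAt ℝ (fun y => R y i j) y := fun y hy i j =>
    (hc y hy i j).differentiableAt (by norm_num)
  have hΩx : ∀ y ∈ Ω, ∀ᶠ z in nhds y, z ∈ Ω := fun y hy => hΩ.mem_nhds hy
  have ho : ∀ y ∈ Ω, ∀ a b, ∑ i, R y i a * R y i b = (1 : Matrix (Fin 3) (Fin 3) ℝ) a b := by
    intro y hy a b
    rw [← (hSO y hy).1]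
    simp [Matrix.mul_apply]
  have ho' : Matrix.of (R x) * (Matrix.of (R x))ᵀ = 1 := mul_eq_one_comm.1 (hSO x hx).1
  have h1 : ∀ y ∈ Ω, ∀ k a b, ∑ i, (pd k (fun y => R y i a) y * R y i b
      + R y i a * pd k (fun y => R y i b) y) = 0 := by
    intro y hy k a b
    exact pd_sum_mul (fun i => hd y hy i a) (fun i => hd y hy i b) k
      ((hΩx y hy).mono fun z hz => ho z hz a b)
  set d : Fin 3 → Fin 3 → Fin 3 → ℝ := fun k i j => pd k (fun y => R y i j) x with hdd
  set s : Fin 3 → Fin 3 → Fin 3 → Fin 3 → ℝ :=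
    fun l k i j => pd l (pd k (fun y => R y i j)) x with hs
  have h2 : ∀ l k i j, s l k i j = s k l i j := fun l k i j => pd_symm (hc x hx i j) k l
  have h3 : ∀ l k a b, ∑ i, (s l k i a * R x i b + d k i a * d l i b
      + d l i a * d k i b + R x i a * s l k i b) = 0 := by
    intro l k a b
    have := pd_sum_mul (ι := Fin 3 ⊕ Fin 3) (x := x) (c := 0)
      (f := Sum.elim (fun i => pd k (fun y => R y i a)) (fun i y => R y i a))
      (g := Sum.elim (fun i y => R y i b) (fun i => pd k (fun y => R y i b)))
      (by rintro (i | i)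
          · exact pd_diff (hc x hx i a) k
          · exact hd x hx i a)
      (by rintro (i | i)
          · exact hd x hx i b
          · exact pd_diff (hc x hx i b) k) l
      ((hΩx x hx).mono fun z hz => by
        rw [← h1 z hz k a b, Fintype.sum_sum_type, Finset.sum_add_distrib]; rfl)
    rw [Fintype.sum_sum_type, ← Finset.sum_add_distrib] at this
    rw [← this]
    refine Finset.sum_congr rfl fun i _ => ?_
    simp only [Sum.elim_inl, Sum.elim_inr, hs, hdd]
    ring
  have h4 : ∀ i l m, ∑ j, ∑ k, eps l j k * s m j i k = 0 := by
    intro i l m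
    have := pd_sum_mul (ι := Fin 3 × Fin 3) (x := x) (c := α i l)
      (f := fun p _ => eps l p.1 p.2) (g := fun p => pd p.1 (fun y => R y i p.2))
      (fun p => differentiableAt_const _) (fun p => pd_diff (hc x hx i p.2) p.1) m
      ((hΩx x hx).mono fun z hz => by
        rw [← hcurl z hz i l, Fintype.sum_prod_type])
    rw [Fintype.sum_prod_type] at this
    rw [← this]
    refine Finset.sum_congr rfl fun j _ => Finset.sum_congr rfl fun k _ => ?_
    have hz : pd m (fun _ : Fin 3 → ℝ => eps l j k) x = 0 := by simp [pd]
    simp only [hz, hs]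
    ring
  have key := alg_second (R x) d s h2 h3 h4
  set W : Fin 3 → Fin 3 → Fin 3 → ℝ := fun k a b => ∑ i, R x i a * d k i b with hWd
  have hWs : ∀ k a b, W k a b = - W k b a := by
    intro k a b
    have := h1 x hx k a b
    rw [Finset.sum_add_distrib] at this
    have e : W k b a = ∑ i, pd k (fun y => R y i a) x * R x i b :=
      Finset.sum_congr rfl fun i _ => mul_comm _ _
    rw [e]
    simp only [hWd, hdd]
    linarith
  have hWW : ∀ k l a b, ∑ i, W k i a * W l i b = ∑ i, d k i a * d l i b := by
    intro k l a b
    have e : ((Matrix.of (R x))ᵀ * Matrix.of (d k))ᵀ * ((Matrix.of (R x))ᵀ * Matrix.of (d l))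
        = (Matrix.of (d k))ᵀ * Matrix.of (d l) := by
      rw [Matrix.transpose_mul, Matrix.transpose_transpose, Matrix.mul_assoc,
        ← Matrix.mul_assoc (Matrix.of (R x)), ho', Matrix.one_mul]
    have := congrFun (congrFun e a) b
    simp only [Matrix.mul_apply, Matrix.transpose_apply, Matrix.of_apply] at this
    exact this
  have hB : ∀ m l, ((Matrix.of (R x))ᵀ * α) m l = ∑ j, ∑ k, eps l j k * W j m k := by
    intro m l
    simp only [Matrix.mul_apply, Matrix.transpose_apply, Matrix.of_apply, hWd]
    simp only [← hcurl x hx _ l]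
    simp only [Fin.sum_univ_three, hdd]
    ring
  have hsq : ∑ i, ∑ j, ∑ k, d k i j ^ 2 = ∑ i, ∑ j, ∑ k, W k i j ^ 2 := by
    have := fun k j => hWW k k j j
    simp only [Fin.sum_univ_three] at this ⊢
    have a := fun k => this k 0
    have b := fun k => this k 1
    have c := fun k => this k 2
    linear_combination -a 0 - a 1 - a 2 - b 0 - b 1 - b 2 - c 0 - c 1 - c 2
  have key2 : ∑ i, ∑ j, ∑ k, W k i j ^ 2
      = 1 / 2 * ∑ k, ∑ j, ∑ i, (W k i k * W j i j + W j i k * W k i j) := by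
    rw [← hsq, key]
    simp only [Finset.sum_add_distrib, hWW]
  have fin := alg_first W _ hWs hB key2
  rw [Matrix.mul_assoc ((Matrix.of (R x))ᵀ * α), ← fin, ← hsq]
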